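/- Let Q be an LDP-polygon with maximal local index m_Q = k, where k ≥ 3 is a prime number. Then the number of boundary lattice points satisfies |∂Q ∩ ℤ²| ≤ 4k(k + 1) − 2. -/

import Mathlib

open Pointwise

/-- The embedding of the lattice `ℤ²` into `ℚ²`. -/
def toQ (p : ℤ × ℤ) : ℚ × ℚ := ((p.1 : ℚ), (p.2 : ℚ))

/-- The pairing between the dual lattice `ℤ²` and `ℚ²`. -/
def pairQ (η : ℤ × ℤ) (x : ℚ × ℚ) : ℚ := (η.1 : ℚ) * x.1 + (η.2 : ℚ) * x.2

/-- A lattice polygon: the convex hull of finitely many lattice points,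
with nonempty interior. -/
def IsLatticePolygon (Q : Set (ℚ × ℚ)) : Prop :=
  (∃ S : Finset (ℤ × ℤ), Q = convexHull ℚ (toQ '' (S : Set (ℤ × ℤ)))) ∧
    (interior Q).Nonempty

/-- An IP-polygon: a lattice polygon containing the origin in its interior. -/
def IsIPPolygon (Q : Set (ℚ × ℚ)) : Prop :=
  IsLatticePolygon Q ∧ (0 : ℚ × ℚ) ∈ interior Q

/-- The vertices of a polygon are its extreme points. -/
def vertices (Q : Set (ℚ × ℚ)) : Set (ℚ × ℚ) := Set.extremePoints ℚ Q

/-- An LDP-polygon: an IP-polygon all of whose vertices are primitive lattice points. -/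
def IsLDPPolygon (Q : Set (ℚ × ℚ)) : Prop :=
  IsIPPolygon Q ∧ ∀ v ∈ vertices Q, ∃ p : ℤ × ℤ, Int.gcd p.1 p.2 = 1 ∧ v = toQ p

/-- `IsFacetWith Q η l F` : `F` is a facet (edge) of `Q` with primitive outer normal
`η` and local index `l`, i.e. `⟨η, x⟩ = l` on `F` and `⟨η, y⟩ ≤ l` on `Q`. -/
def IsFacetWith (Q : Set (ℚ × ℚ)) (η : ℤ × ℤ) (l : ℤ) (F : Set (ℚ × ℚ)) : Prop :=
  Int.gcd η.1 η.2 = 1 ∧ 0 < l ∧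
  (∀ y ∈ Q, pairQ η y ≤ (l : ℚ)) ∧
  F = {x ∈ Q | pairQ η x = (l : ℚ)} ∧
  ∃ x ∈ F, ∃ y ∈ F, x ≠ y

/-- `F` is a facet of `Q`. -/
def IsFacet (Q F : Set (ℚ × ℚ)) : Prop := ∃ η l, IsFacetWith Q η l F

/-- `HasMaxLocalIndex Q k` : the maximal local index `m_Q` of `Q` equals `k`. -/
def HasMaxLocalIndex (Q : Set (ℚ × ℚ)) (k : ℤ) : Prop :=
  (∃ F η, IsFacetWith Q η k F) ∧ ∀ F η l, IsFacetWith Q η l F → l ≤ k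

/-- `HasIndex Q ℓ` : the index `ℓ_Q` of `Q` (the lcm of all local indices) equals `ℓ`. -/
def HasIndex (Q : Set (ℚ × ℚ)) (ℓ : ℤ) : Prop :=
  0 < ℓ ∧ (∀ F η l, IsFacetWith Q η l F → l ∣ ℓ) ∧
  ∀ m : ℤ, 0 < m → (∀ F η l, IsFacetWith Q η l F → l ∣ m) → ℓ ∣ m

/-- The only lattice point in the interior of `(1/k)·Q` is the origin. -/
def NoIntLatticePts (Q : Set (ℚ × ℚ)) (k : ℤ) : Prop :=
  ∀ p : ℤ × ℤ, toQ p ∈ interior (((k : ℚ)⁻¹) • Q) → p = 0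

/-- `HasOrder Q I` : the order `o_Q` of `Q` equals `I`. -/
def HasOrder (Q : Set (ℚ × ℚ)) (I : ℤ) : Prop :=
  1 ≤ I ∧ NoIntLatticePts Q I ∧ ∀ k : ℤ, 1 ≤ k → NoIntLatticePts Q k → I ≤ k

/-- The cone `pos(F) = ℝ≥0·F` spanned by `F` (inside `ℚ²`). -/
def posCone (F : Set (ℚ × ℚ)) : Set (ℚ × ℚ) :=
  {y | ∃ t : ℚ, 0 ≤ t ∧ ∃ z ∈ F, y = t • z}

/-- The number of lattice points in a subset of `ℚ²`. -/
noncomputable def latticeCount (S : Set (ℚ × ℚ)) : ℕ :=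
  {p : ℤ × ℤ | toQ p ∈ S}.ncard

/-- The normalised volume of `Q`: twice the Euclidean area of the corresponding
real region. -/
noncomputable def nVol (Q : Set (ℚ × ℚ)) : ℝ :=
  2 * (MeasureTheory.volume
    (closure ((fun x : ℚ × ℚ => ((x.1 : ℝ), (x.2 : ℝ))) '' Q))).toReal

/-- Unimodular equivalence: `Q'` is the image of `Q` under an element of `GL(2,ℤ)`. -/
def UnimodEquiv (Q Q' : Set (ℚ × ℚ)) : Prop :=
  ∃ a b c d : ℤ, (a * d - b * c = 1 ∨ a * d - b * c = -1) ∧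
    (fun x : ℚ × ℚ => ((a : ℚ) * x.1 + (b : ℚ) * x.2,
      (c : ℚ) * x.1 + (d : ℚ) * x.2)) '' Q = Q'

/-- The integral pairing. -/
def dotZ (n p : ℤ × ℤ) : ℤ := n.1 * p.1 + n.2 * p.2

theorem pairQ_toQ (n p : ℤ × ℤ) : pairQ n (toQ p) = (dotZ n p : ℚ) := by
  simp [pairQ, toQ, dotZ]

theorem pairQ_hull (S : Finset (ℤ × ℤ)) (n : ℤ × ℤ) (l : ℚ)
    (h : ∀ p ∈ S, (dotZ n p : ℚ) ≤ l) :
    ∀ y ∈ convexHull ℚ (toQ '' (S : Set (ℤ × ℤ))), pairQ n y ≤ l := by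
  intro y hy
  have hc : Convex ℚ {x : ℚ × ℚ | pairQ n x ≤ l} := by
    intro x hx y hy a b ha hb hab
    simp only [Set.mem_ofPred_eq, pairQ, Prod.fst_add, Prod.snd_add, Prod.smul_fst,
      Prod.smul_snd, smul_eq_mul] at *
    have h1 := mul_le_mul_of_nonneg_left hx ha
    have h2 := mul_le_mul_of_nonneg_left hy hb
    have h3 : a * l + b * l = l := by rw [← add_mul, hab, one_mul]
    linarith
  refine convexHull_min ?_ hc hy
  rintro _ ⟨p, hp, rfl⟩
  simp only [Set.mem_ofPred_eq, pairQ_toQ]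
  exact h p hp

/-- The origin being interior, each nonzero functional is positive somewhere on `S`. -/
theorem exists_pos (S : Finset (ℤ × ℤ))
    (h0 : (0 : ℚ × ℚ) ∈ interior (convexHull ℚ (toQ '' (S : Set (ℤ × ℤ)))))
    (n : ℤ × ℤ) (hn : n ≠ 0) : ∃ p ∈ S, 0 < dotZ n p := by
  by_contra! hcon
  have hle := pairQ_hull S n 0 (fun p hp => by exact_mod_cast hcon p hp)
  have hnhds := mem_interior_iff_mem_nhds.mp h0
  have hcont : Filter.Tendsto (fun t : ℚ => t • toQ n) (nhds 0) (nhds (0 : ℚ × ℚ)) := by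
    have : Continuous (fun t : ℚ => t • toQ n) := by fun_prop
    simpa using this.tendsto 0
  have hev := hcont.eventually hnhds
  obtain ⟨e, he, hball⟩ := Metric.eventually_nhds_iff.mp hev
  obtain ⟨q, hq0, hqe⟩ := exists_rat_btwn he
  have hq0' : 0 < q := by exact_mod_cast hq0
  have hmem := hball (y := q) (by
    rw [Rat.dist_eq]; simp; rw [abs_of_pos (by exact_mod_cast hq0')]; exact hqe)
  have := hle _ hmem
  simp only [pairQ, toQ, Prod.smul_fst, Prod.smul_snd, smul_eq_mul] at this
  have hpos : 0 < (n.1 : ℚ) ^ 2 + (n.2 : ℚ) ^ 2 := by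
    by_cases h1 : n.1 = 0
    · have h2 : n.2 ≠ 0 := fun h2 => hn (Prod.ext h1 h2)
      have : (n.2 : ℚ) ≠ 0 := by exact_mod_cast h2
      positivity
    · have : (n.1 : ℚ) ≠ 0 := by exact_mod_cast h1
      positivity
  have := mul_pos hq0' hpos
  linarith

/-- Through each ray there is a facet. -/
theorem exists_facet (S : Finset (ℤ × ℤ)) (Q : Set (ℚ × ℚ))
    (hQ : Q = convexHull ℚ (toQ '' (S : Set (ℤ × ℤ))))
    (h0 : (0 : ℚ × ℚ) ∈ interior Q) (u : ℤ × ℤ) (hu : u ≠ 0) :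
    ∃ (η : ℤ × ℤ) (l : ℤ) (F : Set (ℚ × ℚ)), IsFacetWith Q η l F ∧ 0 < dotZ η u ∧
      (∃ a, toQ a ∈ Q ∧ dotZ η a = l) ∧
      ∃ t : ℚ, t • toQ u ∈ Q ∧ t * (dotZ η u : ℚ) = l := by
  have hS := exists_pos S (hQ ▸ h0)
  have hSQ : ∀ p ∈ S, toQ p ∈ Q := fun p hp => by
    rw [hQ]; exact subset_convexHull _ _ ⟨p, hp, rfl⟩
  obtain ⟨X, hX⟩ : ∃ X : ℤ × ℤ → ℤ, ∀ p, X p = u.1 * p.2 - u.2 * p.1 := ⟨_, fun _ => rfl⟩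
  obtain ⟨Y, hY⟩ : ∃ Y : ℤ × ℤ → ℤ, ∀ p, Y p = u.1 * p.1 + u.2 * p.2 := ⟨_, fun _ => rfl⟩
  have huu : 0 < u.1 ^ 2 + u.2 ^ 2 := by
    by_cases h1 : u.1 = 0
    · have h2 : u.2 ≠ 0 := fun h2 => hu (Prod.ext h1 h2)
      positivity
    · positivity
  obtain ⟨b0, hb0, hb0'⟩ := hS (-u.2, u.1) (by
    intro h; apply hu; simp [Prod.ext_iff] at h; exact Prod.ext h.2 h.1)
  obtain ⟨a0, ha0, ha0'⟩ := hS (u.2, -u.1) (by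
    intro h; apply hu; simp [Prod.ext_iff] at h; exact Prod.ext h.2 h.1)
  simp only [dotZ] at hb0' ha0'
  let T := (S ×ˢ S).filter (fun q => X q.1 ≤ 0 ∧ 0 < X q.2)
  have hT : ∀ q, q ∈ T ↔ (q.1 ∈ S ∧ q.2 ∈ S) ∧ X q.1 ≤ 0 ∧ 0 < X q.2 := by
    intro q; simp [T]
  let tt : (ℤ × ℤ) × (ℤ × ℤ) → ℚ := fun q =>
    ((X q.2 * Y q.1 - X q.1 * Y q.2 : ℤ) : ℚ) / ((X q.2 - X q.1 : ℤ) : ℚ)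
  let mm : (ℤ × ℤ) × (ℤ × ℤ) → ℚ := fun q =>
    ((Y q.2 - Y q.1 : ℤ) : ℚ) / ((X q.2 - X q.1 : ℤ) : ℚ)
  have hTne : T.Nonempty := ⟨(a0, b0), by
    rw [hT]; refine ⟨⟨ha0, hb0⟩, ?_, ?_⟩ <;> simp only [hX] <;> linarith⟩
  obtain ⟨q1, hq1, hmax1⟩ := Finset.exists_max_image T tt hTne
  obtain ⟨q2, hq2, hmax2⟩ := Finset.exists_max_image (T.filter (fun q => tt q = tt q1)) mm
    ⟨q1, by simp [hq1]⟩
  rw [Finset.mem_filter] at hq2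
  obtain ⟨⟨a, b⟩, hab⟩ : ∃ q, q = q2 := ⟨_, rfl⟩
  subst hab
  obtain ⟨hq2T, hq2t⟩ := hq2
  have hq2T' := (hT _).1 hq2T
  obtain ⟨⟨haS, hbS⟩, hXa, hXb⟩ := hq2T'
  simp only at haS hbS hXa hXb
  have hmaxt : ∀ q ∈ T, tt q ≤ tt (a, b) := fun q hq => by rw [hq2t]; exact hmax1 q hq
  have hmaxm : ∀ q ∈ T, tt q = tt (a, b) → mm q ≤ mm (a, b) := fun q hq h =>
    hmax2 q (Finset.mem_filter.2 ⟨hq, by rw [h, hq2t]⟩)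
  have hD : 0 < X b - X a := by linarith
  have key : ∀ c ∈ S, (X b - X a) * Y c - (Y b - Y a) * X c ≤ X b * Y a - X a * Y b := by
    intro c hc
    rcases le_or_gt (X c) 0 with hXc | hXc
    · have h1 := hmaxt (c, b) ((hT _).2 ⟨⟨hc, hbS⟩, hXc, hXb⟩)
      simp only [tt] at h1
      rw [div_le_div_iff₀ (by exact_mod_cast (by linarith : 0 < X b - X c))
        (by exact_mod_cast hD)] at h1
      have h2 : (X b * Y c - X c * Y b) * (X b - X a) ≤
        (X b * Y a - X a * Y b) * (X b - X c) := by exact_mod_cast h1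
      by_contra! hcon
      have := mul_lt_mul_of_pos_left hcon hXb
      nlinarith
    · rcases lt_or_eq_of_le hXa with hXa' | hXa'
      · have h1 := hmaxt (a, c) ((hT _).2 ⟨⟨haS, hc⟩, hXa, hXc⟩)
        simp only [tt] at h1
        rw [div_le_div_iff₀ (by exact_mod_cast (by linarith : 0 < X c - X a))
          (by exact_mod_cast hD)] at h1
        have h2 : (X c * Y a - X a * Y c) * (X b - X a) ≤
          (X b * Y a - X a * Y b) * (X c - X a) := by exact_mod_cast h1
        by_contra! hcon
        have := mul_lt_mul_of_pos_left hcon (neg_pos.2 hXa')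
        nlinarith
      · have hc0 : (X c : ℚ) ≠ 0 := by exact_mod_cast hXc.ne'
        have hb0 : (X b : ℚ) ≠ 0 := by exact_mod_cast hXb.ne'
        have h1 := hmaxm (a, c) ((hT _).2 ⟨⟨haS, hc⟩, hXa, hXc⟩) (by
          simp only [tt, hXa']; push_cast; field_simp; simp; ring)
        simp only [mm, hXa', sub_zero] at h1
        rw [div_le_div_iff₀ (by exact_mod_cast hXc) (by exact_mod_cast hXb)] at h1
        have h2 : (Y c - Y a) * X b ≤ (Y b - Y a) * X c := by exact_mod_cast h1
        rw [hXa']; nlinarith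
  obtain ⟨n, hn⟩ : ∃ n : ℤ × ℤ, n = ((X b - X a) * u.1 + (Y b - Y a) * u.2,
    (X b - X a) * u.2 - (Y b - Y a) * u.1) := ⟨_, rfl⟩
  have hnp : ∀ p, dotZ n p = (X b - X a) * Y p - (Y b - Y a) * X p := by
    intro p; simp only [dotZ, hn, hX p, hY p]; ring
  have hna : dotZ n a = X b * Y a - X a * Y b := by rw [hnp]; ring
  have hnb : dotZ n b = X b * Y a - X a * Y b := by rw [hnp]; ring
  have hnu : dotZ n u = (X b - X a) * (u.1 ^ 2 + u.2 ^ 2) := by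
    rw [hnp, hX u, hY u]; ring
  have hnu0 : 0 < dotZ n u := by rw [hnu]; positivity
  have hn0 : n ≠ 0 := by
    rintro h; rw [h] at hnu0; simp [dotZ] at hnu0
  have hg0 : 0 < Int.gcd n.1 n.2 := by
    rw [Int.gcd_pos_iff]; by_contra! h; exact hn0 (Prod.ext h.1 h.2)
  obtain ⟨η1, η2, hη, hη1, hη2⟩ := Int.exists_gcd_one hg0
  obtain ⟨g, hg⟩ : ∃ g : ℤ, g = (Int.gcd n.1 n.2 : ℤ) := ⟨_, rfl⟩
  have hgpos : 0 < g := by rw [hg]; exact_mod_cast hg0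
  rw [← hg] at hη1 hη2
  have hgη : ∀ p, dotZ n p = g * dotZ (η1, η2) p := by
    intro p; simp only [dotZ]; rw [hη1, hη2]; ring
  have hηle : ∀ p ∈ S, dotZ (η1, η2) p ≤ dotZ (η1, η2) a := by
    intro p hp
    have := key p hp
    rw [← hnp, ← hna, hgη, hgη] at this
    exact le_of_mul_le_mul_left this hgpos
  have hηab : dotZ (η1, η2) b = dotZ (η1, η2) a := by
    have := hnb
    rw [← hna, hgη, hgη] at this
    exact mul_left_cancel₀ hgpos.ne' this
  have hl : 0 < dotZ (η1, η2) a := by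
    obtain ⟨p, hp, hp0⟩ := hS n hn0
    rw [hgη] at hp0
    exact lt_of_lt_of_le (pos_of_mul_pos_right hp0 hgpos.le) (hηle p hp)
  have hηu : 0 < dotZ (η1, η2) u := by
    rw [hgη] at hnu0; exact pos_of_mul_pos_right hnu0 hgpos.le
  have hDQ : (0 : ℚ) < (X b : ℚ) - X a := by exact_mod_cast hD
  refine ⟨(η1, η2), dotZ (η1, η2) a, _, ⟨hη, hl, ?_, rfl, toQ a, ?_, toQ b, ?_, ?_⟩, hηu,
    ⟨a, hSQ a haS, rfl⟩, (dotZ (η1, η2) a : ℚ) / dotZ (η1, η2) u, ?_, ?_⟩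
  · rw [hQ]
    exact pairQ_hull S _ _ (fun p hp => by exact_mod_cast hηle p hp)
  · exact ⟨hSQ a haS, pairQ_toQ _ _⟩
  · exact ⟨hSQ b hbS, by rw [pairQ_toQ, hηab]⟩
  · intro h
    simp only [toQ, Prod.mk.injEq, Int.cast_inj] at h
    have : a = b := Prod.ext h.1 h.2
    rw [this] at hD; simp at hD
  · have hconv : Convex ℚ Q := hQ ▸ convex_convexHull _ _
    have hm := hconv (hSQ a haS) (hSQ b hbS) (a := (X b : ℚ) / (X b - X a))
      (b := (-(X a : ℚ)) / (X b - X a))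
      (div_nonneg (by exact_mod_cast hXb.le) hDQ.le)
      (div_nonneg (by have : (X a : ℚ) ≤ 0 := by exact_mod_cast hXa
                      linarith) hDQ.le) (by field_simp; ring)
    convert hm using 1
    have hr : (dotZ (η1, η2) a : ℚ) / dotZ (η1, η2) u =
        (X b * Y a - X a * Y b) / ((X b - X a) * ((u.1 : ℚ) ^ 2 + (u.2 : ℚ) ^ 2)) := by
      have e1 : (g : ℚ) * dotZ (η1, η2) a = X b * Y a - X a * Y b := by
        exact_mod_cast (hgη a).symm.trans hna
      have e2 : (g : ℚ) * dotZ (η1, η2) u =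
        ((X b - X a) * ((u.1 : ℚ) ^ 2 + (u.2 : ℚ) ^ 2)) := by
        exact_mod_cast (hgη u).symm.trans hnu
      rw [← e1, ← e2, mul_div_mul_left]
      exact_mod_cast hgpos.ne'
    rw [hr]
    have huuQ : (u.1 : ℚ) ^ 2 + (u.2 : ℚ) ^ 2 ≠ 0 := by exact_mod_cast huu.ne'
    have hDQ' := hDQ.ne'
    have hxa : (X a : ℚ) = u.1 * a.2 - u.2 * a.1 := by rw [hX]; push_cast; ring
    have hxb : (X b : ℚ) = u.1 * b.2 - u.2 * b.1 := by rw [hX]; push_cast; ring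
    have hya : (Y a : ℚ) = u.1 * a.1 + u.2 * a.2 := by rw [hY]; push_cast; ring
    have hyb : (Y b : ℚ) = u.1 * b.1 + u.2 * b.2 := by rw [hY]; push_cast; ring
    apply Prod.ext
    · simp only [toQ, Prod.smul_fst, Prod.fst_add, smul_eq_mul]
      field_simp
      rw [hya, hyb, hxa, hxb]; ring
    · simp only [toQ, Prod.smul_snd, Prod.snd_add, smul_eq_mul]
      field_simp
      rw [hya, hyb, hxa, hxb]; ring
  · have : (dotZ (η1, η2) u : ℚ) ≠ 0 := by exact_mod_cast hηu.ne'
    field_simp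

/-- Boundary lattice points lie on a facet. -/
theorem frontier_facet (S : Finset (ℤ × ℤ)) (Q : Set (ℚ × ℚ))
    (hQ : Q = convexHull ℚ (toQ '' (S : Set (ℤ × ℤ))))
    (h0 : (0 : ℚ × ℚ) ∈ interior Q) (p : ℤ × ℤ) (hp : toQ p ∈ frontier Q) :
    toQ p ∈ Q ∧ ∃ (η : ℤ × ℤ) (l : ℤ) (F : Set (ℚ × ℚ)),
      IsFacetWith Q η l F ∧ dotZ η p = l := by
  have hp0 : p ≠ 0 := by
    rintro rfl
    exact hp.2 (by
      have e : toQ 0 = 0 := by ext <;> simp [toQ]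
      rw [e]; exact h0)
  obtain ⟨η, l, F, hF, hu, -, t, htQ, ht⟩ := exists_facet S Q hQ h0 p hp0
  have hcl : pairQ η (toQ p) ≤ l := by
    have hclosed : IsClosed {x : ℚ × ℚ | pairQ η x ≤ l} := by
      apply isClosed_le _ continuous_const
      unfold pairQ; fun_prop
    exact closure_minimal (fun x hx => hF.2.2.1 x hx) hclosed hp.1
  rw [pairQ_toQ] at hcl
  have huQ : (0 : ℚ) < dotZ η p := by exact_mod_cast hu
  have ht1 : 1 ≤ t := by
    by_contra! h
    nlinarith
  have hconv : Convex ℚ Q := hQ ▸ convex_convexHull _ _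
  have ht2 : t = 1 := by
    by_contra h
    have h1 : 1 < t := lt_of_le_of_ne ht1 (Ne.symm h)
    apply hp.2
    have hi : t⁻¹ < 1 := inv_lt_one_of_one_lt₀ h1
    have := hconv.combo_interior_self_mem_interior h0 htQ (a := 1 - t⁻¹) (b := t⁻¹)
      (by linarith) (by positivity) (by ring)
    rw [smul_zero, zero_add, smul_smul, inv_mul_cancel₀ (by positivity), one_smul] at this
    exact this
  subst ht2
  rw [one_smul] at htQ
  refine ⟨htQ, η, l, F, hF, ?_⟩
  rw [one_mul] at ht
  exact_mod_cast ht

/-- A finite set of lattice points at the same height between `x1` and `x2`. -/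
theorem card_row (T : Finset (ℤ × ℤ)) (f : ℤ × ℤ → ℤ) (hinj : Set.InjOn f T) (x1 x2 : ℤ)
    (h : ∀ p ∈ T, x1 ≤ f p ∧ f p ≤ x2) (hx : x1 ≤ x2) : (T.card : ℤ) ≤ x2 - x1 + 1 := by
  have h1 : T.card ≤ (Finset.Icc x1 x2).card :=
    Finset.card_le_card_of_injOn f (fun p hp => by simpa using h p hp) hinj
  rw [Int.card_Icc] at h1
  omega

set_option maxHeartbeats 2000000 in
/-- The combinatorial core. -/
theorem core (L : Set (ℤ × ℤ)) (Φ : ℤ × ℤ → ℤ → Prop) (B : Finset (ℤ × ℤ)) (k : ℤ)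
    (hk : 3 ≤ k)
    (hΦ : ∀ n c, Φ n c → 0 < c ∧ c ≤ k ∧ ∀ p ∈ L, dotZ n p ≤ c)
    (hBL : ∀ p ∈ B, p ∈ L)
    (hB : ∀ p ∈ B, ∃ n c, Φ n c ∧ dotZ n p = c)
    (hray : ∀ u : ℤ × ℤ, u ≠ 0 → ∃ n c, Φ n c ∧ 0 < dotZ n u)
    (η : ℤ × ℤ) (l : ℤ) (hη : Int.gcd η.1 η.2 = 1) (hηl : Φ η l)
    (hs : 0 ≤ ∑ p ∈ B, dotZ η p)
    (a0 : ℤ × ℤ) (ha0 : a0 ∈ L) (ha0l : dotZ η a0 = l)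
    (p0 : ℤ × ℤ) (hp0 : p0 ∈ L) (hp0n : dotZ η p0 < 0)
    (hlow : ∀ p ∈ B, dotZ η p0 ≤ dotZ η p) :
    (B.card : ℤ) ≤ 4 * k * (k + 1) - 2 := by
  obtain ⟨hl0, hlk, hlL⟩ := hΦ η l hηl
  obtain ⟨h, hh⟩ : ∃ h, h = - dotZ η p0 := ⟨_, rfl⟩
  have hh0 : 0 < h := by linarith
  -- the complementary coordinate
  obtain ⟨ξ, hξ⟩ : ∃ ξ : ℤ × ℤ, η.1 * ξ.2 - η.2 * ξ.1 = 1 := by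
    have := Int.gcd_eq_gcd_ab η.1 η.2
    rw [hη] at this
    exact ⟨(-Int.gcdB η.1 η.2, Int.gcdA η.1 η.2), by push_cast at this; linarith⟩
  have hdec : ∀ n p : ℤ × ℤ, dotZ n p =
      dotZ n (ξ.2, -ξ.1) * dotZ η p + dotZ n (-η.2, η.1) * dotZ ξ p := by
    intro n p
    have : dotZ n p = (η.1 * ξ.2 - η.2 * ξ.1) * dotZ n p := by rw [hξ, one_mul]
    rw [this]; simp only [dotZ]; ring
  have hinj : ∀ p q : ℤ × ℤ, dotZ η p = dotZ η q → dotZ ξ p = dotZ ξ q → p = q := by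
    intro p q h1 h2
    apply Prod.ext
    · have e1 := hdec (1, 0) p
      have e2 := hdec (1, 0) q
      rw [h1, h2, ← e2] at e1
      simpa [dotZ] using e1
    · have e1 := hdec (0, 1) p
      have e2 := hdec (0, 1) q
      rw [h1, h2, ← e2] at e1
      simpa [dotZ] using e1
  -- no three points in a middle row
  have hmid3 : ∀ p ∈ B, ∀ m ∈ B, ∀ q ∈ B, dotZ η p = dotZ η m → dotZ η q = dotZ η m →
      -h < dotZ η m → dotZ η m < l → dotZ ξ p < dotZ ξ m → dotZ ξ m < dotZ ξ q → False := by
    intro p hp m hm q hq h1 h2 hj1 hj2 hx1 hx2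
    obtain ⟨n, c, hnc, hnm⟩ := hB m hm
    obtain ⟨hc0, -, hcL⟩ := hΦ n c hnc
    have ep := hcL p (hBL p hp)
    have eq := hcL q (hBL q hq)
    have ea := hcL a0 ha0
    have eb := hcL p0 hp0
    rw [hdec] at ep eq ea eb hnm
    rw [h1] at ep
    rw [h2] at eq
    rw [ha0l] at ea
    have hh' : dotZ η p0 = -h := by linarith
    rw [hh'] at eb
    generalize dotZ n (ξ.2, -ξ.1) = α at *
    generalize dotZ n (-η.2, η.1) = β at *
    have hβ1 : 0 ≤ β := by
      by_contra! hb
      nlinarith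
    have hβ2 : β ≤ 0 := by
      by_contra! hb
      nlinarith
    have hβ : β = 0 := le_antisymm hβ2 hβ1
    subst hβ
    simp only [zero_mul, add_zero] at *
    rcases lt_trichotomy α 0 with ha | ha | ha
    · nlinarith
    · subst ha; simp at hnm; omega
    · nlinarith
  have hrow : ∀ j, -h < j → j < l → (B.filter (fun p => dotZ η p = j)).card ≤ 2 := by
    intro j hj1 hj2
    by_contra! hcon
    obtain ⟨p, hp, m, hm, q, hq, hpm, hpq, hmq⟩ := Finset.two_lt_card.mp hcon
    rw [Finset.mem_filter] at hp hm hq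
    obtain ⟨hp, hpj⟩ := hp
    obtain ⟨hm, hmj⟩ := hm
    obtain ⟨hq, hqj⟩ := hq
    have x1 : dotZ ξ p ≠ dotZ ξ m := fun e => hpm (hinj _ _ (by omega) e)
    have x2 : dotZ ξ p ≠ dotZ ξ q := fun e => hpq (hinj _ _ (by omega) e)
    have x3 : dotZ ξ m ≠ dotZ ξ q := fun e => hmq (hinj _ _ (by omega) e)
    have F : ∀ p ∈ B, ∀ m ∈ B, ∀ q ∈ B, dotZ η p = j → dotZ η m = j → dotZ η q = j →
        dotZ ξ p < dotZ ξ m → dotZ ξ m < dotZ ξ q → False :=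
      fun p hp m hm q hq e1 e2 e3 => hmid3 p hp m hm q hq (by omega) (by omega)
        (by omega) (by omega)
    rcases lt_or_gt_of_ne x1 with y1 | y1 <;> rcases lt_or_gt_of_ne x2 with y2 | y2 <;>
      rcases lt_or_gt_of_ne x3 with y3 | y3
    · exact F p hp m hm q hq hpj hmj hqj y1 y3
    · exact F p hp q hq m hm hpj hqj hmj y2 y3
    · omega
    · exact F q hq p hp m hm hqj hpj hmj y2 y1
    · exact F m hm p hp q hq hmj hpj hqj y1 y2
    · omega
    · exact F m hm q hq p hp hmj hqj hpj y3 y2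
    · exact F q hq m hm p hp hqj hmj hpj y3 y1
  have hrows : ∀ i j, -h < i → j ≤ l → i ≤ j →
      ((B.filter (fun p => i ≤ dotZ η p ∧ dotZ η p < j)).card : ℤ) ≤ 2 * (j - i) := by
    intro i j hi hj hij
    have := Finset.card_le_mul_card_image_of_maps_to
      (s := B.filter (fun p => i ≤ dotZ η p ∧ dotZ η p < j)) (t := Finset.Ico i j)
      (f := fun p => dotZ η p) (fun p hp => by simpa using (Finset.mem_filter.1 hp).2) 2
      (fun b hb => by
        rw [Finset.mem_Ico] at hb
        refine le_trans (Finset.card_le_card ?_) (hrow b (by omega) (by omega))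
        intro p hp
        simp only [Finset.mem_filter] at hp ⊢
        exact ⟨hp.1.1, hp.2⟩)
    rw [Int.card_Ico] at this
    omega
  -- top and bottom rows
  let T := insert a0 (B.filter (fun p => dotZ η p = l))
  let Z := insert p0 (B.filter (fun p => dotZ η p = -h))
  have hTm : ∀ p ∈ T, p ∈ L ∧ dotZ η p = l := by
    intro p hp
    rcases Finset.mem_insert.1 hp with rfl | hp
    · exact ⟨ha0, ha0l⟩
    · rw [Finset.mem_filter] at hp; exact ⟨hBL p hp.1, hp.2⟩
  have hZm : ∀ p ∈ Z, p ∈ L ∧ dotZ η p = -h := by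
    intro p hp
    rcases Finset.mem_insert.1 hp with rfl | hp
    · exact ⟨hp0, by omega⟩
    · rw [Finset.mem_filter] at hp; exact ⟨hBL p hp.1, hp.2⟩
  have hTne : T.Nonempty := ⟨a0, Finset.mem_insert_self _ _⟩
  have hZne : Z.Nonempty := ⟨p0, Finset.mem_insert_self _ _⟩
  obtain ⟨t2, ht2, ht2m⟩ := Finset.exists_max_image T (dotZ ξ) hTne
  obtain ⟨t1, ht1, ht1m⟩ := Finset.exists_min_image T (dotZ ξ) hTne
  obtain ⟨z2, hz2, hz2m⟩ := Finset.exists_max_image Z (dotZ ξ) hZne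
  obtain ⟨z1, hz1, hz1m⟩ := Finset.exists_min_image Z (dotZ ξ) hZne
  have hTc := card_row T (dotZ ξ) (fun p hp q hq e =>
    hinj p q ((hTm p hp).2.trans (hTm q hq).2.symm) e) (dotZ ξ t1) (dotZ ξ t2)
    (fun p hp => ⟨ht1m p hp, ht2m p hp⟩) (ht1m _ ht2)
  have hZc := card_row Z (dotZ ξ) (fun p hp q hq e =>
    hinj p q ((hZm p hp).2.trans (hZm q hq).2.symm) e) (dotZ ξ z1) (dotZ ξ z2)
    (fun p hp => ⟨hz1m p hp, hz2m p hp⟩) (hz1m _ hz2)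
  have hTB : ((B.filter (fun p => dotZ η p = l)).card : ℤ) ≤ T.card := by
    exact_mod_cast Finset.card_le_card (Finset.subset_insert _ _)
  have hZB : ((B.filter (fun p => dotZ η p = -h)).card : ℤ) ≤ Z.card := by
    exact_mod_cast Finset.card_le_card (Finset.subset_insert _ _)
  have hη0 : η ≠ 0 := by
    rintro rfl; simp at hη
  have hright : ∀ p ∈ T, ∀ q ∈ Z, h * dotZ ξ p + l * dotZ ξ q ≤ k * (l + h) := by
    intro p hp q hq
    obtain ⟨n, c, hnc, hnu⟩ := hray (-η.2, η.1) (by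
      intro e; simp [Prod.ext_iff] at e; exact hη0 (Prod.ext e.2 e.1))
    obtain ⟨hc0, hck, hcL⟩ := hΦ n c hnc
    have e1 := hcL p (hTm p hp).1
    have e2 := hcL q (hZm q hq).1
    rw [hdec, (hTm p hp).2] at e1
    rw [hdec, (hZm q hq).2] at e2
    generalize dotZ n (ξ.2, -ξ.1) = α at *
    generalize dotZ n (-η.2, η.1) = β at *
    have e3 : β * (h * dotZ ξ p + l * dotZ ξ q) ≤ c * (l + h) := by
      have := mul_le_mul_of_nonneg_left e1 hh0.le
      have := mul_le_mul_of_nonneg_left e2 hl0.le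
      nlinarith
    have e4 : c * (l + h) ≤ k * (l + h) := mul_le_mul_of_nonneg_right hck (by linarith)
    rcases le_or_gt (h * dotZ ξ p + l * dotZ ξ q) 0 with e | e
    · exact e.trans (by positivity)
    · nlinarith
  have hleft : ∀ p ∈ T, ∀ q ∈ Z, -(h * dotZ ξ p + l * dotZ ξ q) ≤ k * (l + h) := by
    intro p hp q hq
    obtain ⟨n, c, hnc, hnu⟩ := hray (η.2, -η.1) (by
      intro e; simp [Prod.ext_iff] at e; exact hη0 (Prod.ext e.2 e.1))
    obtain ⟨hc0, hck, hcL⟩ := hΦ n c hnc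
    have e1 := hcL p (hTm p hp).1
    have e2 := hcL q (hZm q hq).1
    rw [hdec, (hTm p hp).2] at e1
    rw [hdec, (hZm q hq).2] at e2
    have hneg : dotZ n (η.2, -η.1) = - dotZ n (-η.2, η.1) := by simp only [dotZ]; ring
    rw [hneg] at hnu
    generalize dotZ n (ξ.2, -ξ.1) = α at *
    generalize dotZ n (-η.2, η.1) = β at *
    have e3 : β * (h * dotZ ξ p + l * dotZ ξ q) ≤ c * (l + h) := by
      have := mul_le_mul_of_nonneg_left e1 hh0.le
      have := mul_le_mul_of_nonneg_left e2 hl0.le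
      nlinarith
    have e4 : c * (l + h) ≤ k * (l + h) := mul_le_mul_of_nonneg_right hck (by linarith)
    rcases le_or_gt (-(h * dotZ ξ p + l * dotZ ξ q)) 0 with e | e
    · exact e.trans (by positivity)
    · nlinarith
  have hw1 := hright t2 ht2 z2 hz2
  have hw2 := hleft t1 ht1 z1 hz1
  have hW0 := ht1m _ ht2
  have hw0 := hz1m _ hz2
  obtain ⟨W, hW⟩ : ∃ W, W = dotZ ξ t2 - dotZ ξ t1 := ⟨_, rfl⟩
  obtain ⟨w, hw⟩ : ∃ w, w = dotZ ξ z2 - dotZ ξ z1 := ⟨_, rfl⟩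
  have hW0' : 0 ≤ W := by linarith
  have hw0' : 0 ≤ w := by linarith
  have hWw : h * W + l * w ≤ 2 * k * (l + h) := by rw [hW, hw]; nlinarith
  have hTB' : ((B.filter (fun p => dotZ η p = l)).card : ℤ) ≤ W + 1 := by linarith
  have hZB' : ((B.filter (fun p => dotZ η p = -h)).card : ℤ) ≤ w + 1 := by linarith
  have hBl : ∀ p ∈ B, dotZ η p ≤ l := fun p hp => hlL p (hBL p hp)
  rcases le_or_gt h l with hhl | hhl
  · -- shallow case
    have hsub : B ⊆ (B.filter (fun p => dotZ η p = l) ∪ B.filter (fun p => dotZ η p = -h)) ∪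
        B.filter (fun p => -h + 1 ≤ dotZ η p ∧ dotZ η p < l) := by
      intro p hp
      have h1 := hBl p hp
      have h2 := hlow p hp
      simp only [Finset.mem_union, Finset.mem_filter, hp, true_and]
      omega
    have h1 := (Finset.card_le_card hsub).trans ((Finset.card_union_le _ _).trans
      (Nat.add_le_add_right (Finset.card_union_le _ _) _))
    have h2 := hrows (-h + 1) l (by linarith) le_rfl (by linarith)
    have h3 : (B.card : ℤ) ≤ W + w + 2 * (l + h) := by
      have : (B.card : ℤ) ≤ (((B.filter (fun p => dotZ η p = l)).card : ℤ) +
        (B.filter (fun p => dotZ η p = -h)).card) +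
        (B.filter (fun p => -h + 1 ≤ dotZ η p ∧ dotZ η p < l)).card := by exact_mod_cast h1
      linarith
    have h4 : W + w ≤ 2 * k * (l + 1) := by
      have a1 : h * (W + w) ≤ 2 * k * (l + h) := by nlinarith
      have a2 : l + h ≤ h * (l + 1) := by nlinarith
      have a3 : 2 * k * (l + h) ≤ 2 * k * (h * (l + 1)) :=
        mul_le_mul_of_nonneg_left a2 (by linarith)
      have a4 : h * (W + w) ≤ h * (2 * k * (l + 1)) := by linarith
      exact le_of_mul_le_mul_left a4 hh0
    nlinarith
  · -- deep case
    have hW4 : W ≤ 4 * k := by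
      have a1 : 0 ≤ l * w := by positivity
      have a2 : h * W ≤ h * (4 * k) := by nlinarith
      exact le_of_mul_le_mul_left a2 hh0
    have c0 := hrows 0 l (by linarith) le_rfl hl0.le
    have c1 : ((B.filter (fun p => dotZ η p = -1)).card : ℤ) ≤ 2 := by
      exact_mod_cast hrow (-1) (by linarith) (by linarith)
    -- weight inequality, pointwise
    have hsplit : ∀ f : ℤ × ℤ → ℤ, ∑ p ∈ B, f p =
        ∑ p ∈ B.filter (fun p => dotZ η p = l), f p +
        ∑ p ∈ B.filter (fun p => 0 ≤ dotZ η p ∧ dotZ η p < l), f p +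
        ∑ p ∈ B.filter (fun p => dotZ η p = -1), f p +
        ∑ p ∈ B.filter (fun p => dotZ η p ≤ -2), f p := by
      intro f
      simp only [Finset.sum_filter, ← Finset.sum_add_distrib]
      apply Finset.sum_congr rfl
      intro p hp
      have := hBl p hp
      split_ifs <;> first | omega | simp
    have e0 := hsplit (fun _ => 1)
    simp only [Finset.sum_const, nsmul_eq_mul, mul_one] at e0
    have e1 := hsplit (fun p => dotZ η p)
    have b1 := Finset.sum_le_card_nsmul (B.filter (fun p => dotZ η p = l))
      (fun p => dotZ η p) l (fun p hp => (Finset.mem_filter.1 hp).2.le)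
    have b2 := Finset.sum_le_card_nsmul (B.filter (fun p => 0 ≤ dotZ η p ∧ dotZ η p < l))
      (fun p => dotZ η p) (l - 1) (fun p hp => by
        have := (Finset.mem_filter.1 hp).2.2
        linarith)
    have b3 := Finset.sum_le_card_nsmul (B.filter (fun p => dotZ η p = -1))
      (fun p => dotZ η p) (-1) (fun p hp => (Finset.mem_filter.1 hp).2.le)
    have b4 := Finset.sum_le_card_nsmul (B.filter (fun p => dotZ η p ≤ -2))
      (fun p => dotZ η p) (-2) (fun p hp => (Finset.mem_filter.1 hp).2)
    simp only [nsmul_eq_mul] at b1 b2 b3 b4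
    generalize ((B.filter (fun p => dotZ η p = l)).card : ℤ) = n1 at *
    generalize ((B.filter (fun p => 0 ≤ dotZ η p ∧ dotZ η p < l)).card : ℤ) = n2 at *
    generalize ((B.filter (fun p => dotZ η p = -1)).card : ℤ) = n3 at *
    generalize ((B.filter (fun p => dotZ η p ≤ -2)).card : ℤ) = n4 at *
    have g1 : n1 * l ≤ (4 * k + 1) * k := by
      have a1 : n1 * l ≤ (4 * k + 1) * l := mul_le_mul_of_nonneg_right (by linarith) hl0.le
      have a2 : (4 * k + 1) * l ≤ (4 * k + 1) * k := mul_le_mul_of_nonneg_left hlk (by linarith)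
      linarith
    have g2 : n2 * (l - 1) ≤ 2 * k * (k - 1) := by
      have a1 : n2 * (l - 1) ≤ (2 * k) * (l - 1) :=
        mul_le_mul_of_nonneg_right (by linarith) (by linarith)
      have a2 : (2 * k) * (l - 1) ≤ (2 * k) * (k - 1) :=
        mul_le_mul_of_nonneg_left (by linarith) (by linarith)
      linarith
    have g3 : 2 * n4 + n3 ≤ (4 * k + 1) * k + 2 * k * (k - 1) := by linarith
    have g4 : 2 * (B.card : ℤ) ≤ 2 * (4 * k + 1) + 2 * (2 * k) + 2 +
        ((4 * k + 1) * k + 2 * k * (k - 1)) := by linarith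
    nlinarith

/-- If `Q` is an LDP-polygon of maximal local index `m_Q = k`, where `k ≥ 3` is
prime, then `|∂Q ∩ ℤ²| ≤ 4k(k + 1) − 2`. -/
theorem boundary_lattice_points_bound_LDP_prime
    (Q : Set (ℚ × ℚ)) (k : ℤ) (hQ : IsLDPPolygon Q) (hk : 3 ≤ k) (hp : Prime k)
    (hmax : HasMaxLocalIndex Q k) :
    (latticeCount (frontier Q) : ℤ) ≤ 4 * k * (k + 1) - 2 := by
  obtain ⟨⟨⟨⟨S, hS⟩, -⟩, h0⟩, -⟩ := hQ
  unfold latticeCount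
  rcases Set.finite_or_infinite {p : ℤ × ℤ | toQ p ∈ frontier Q} with hfin | hinf
  swap
  · rw [hinf.ncard]; push_cast; nlinarith
  rw [Set.ncard_eq_toFinset_card _ hfin]
  have hBm : ∀ p ∈ hfin.toFinset, toQ p ∈ frontier Q := fun p hp => by simpa using hp
  generalize hfin.toFinset = B at *
  have hex : ∃ (η : ℤ × ℤ) (l : ℤ) (F : Set (ℚ × ℚ)), IsFacetWith Q η l F ∧
      (∃ a, toQ a ∈ Q ∧ dotZ η a = l) ∧ 0 ≤ ∑ p ∈ B, dotZ η p := by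
    have hsum : ∀ η : ℤ × ℤ, ∑ p ∈ B, dotZ η p = dotZ η (∑ p ∈ B, p) := by
      intro η
      simp only [dotZ, Prod.fst_sum, Prod.snd_sum, Finset.mul_sum, Finset.sum_add_distrib]
    by_cases hs : ∑ p ∈ B, p = 0
    · obtain ⟨η, l, F, hF, -, ha, -⟩ := exists_facet S Q hS h0 (1, 0) (by simp)
      exact ⟨η, l, F, hF, ha, by rw [hsum, hs]; simp [dotZ]⟩
    · obtain ⟨η, l, F, hF, hu, ha, -⟩ := exists_facet S Q hS h0 _ hs
      exact ⟨η, l, F, hF, ha, by rw [hsum]; exact hu.le⟩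
  obtain ⟨η, l, F, hF, ⟨a0, ha0, ha0l⟩, hs⟩ := hex
  have hηne : -η ≠ 0 := by
    intro e
    have := hF.1
    rw [neg_eq_zero.1 e] at this
    simp at this
  obtain ⟨p1, hp1, hp1n⟩ := exists_pos S (hS ▸ h0) (-η) hηne
  obtain ⟨p0, hp0, hp0m⟩ := Finset.exists_min_image S (dotZ η) ⟨p1, hp1⟩
  have hSQ : ∀ p ∈ S, toQ p ∈ Q := fun p hp => by
    rw [hS]; exact subset_convexHull _ _ ⟨p, hp, rfl⟩
  have hdn : ∀ p, dotZ (-η) p = - dotZ η p := by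
    intro p; simp only [dotZ, Prod.fst_neg, Prod.snd_neg]; ring
  have hbot : ∀ p, toQ p ∈ Q → dotZ η p0 ≤ dotZ η p := by
    intro p hp
    have := pairQ_hull S (-η) (-(dotZ η p0 : ℚ)) (fun q hq => by
      have := hp0m q hq
      rw [hdn]; push_cast
      have : (dotZ η p0 : ℚ) ≤ dotZ η q := by exact_mod_cast this
      linarith) (toQ p) (hS ▸ hp)
    rw [pairQ_toQ, hdn] at this
    push_cast at this
    have : (dotZ η p0 : ℚ) ≤ dotZ η p := by linarith
    exact_mod_cast this
  refine core {p | toQ p ∈ Q} (fun n c => ∃ F, IsFacetWith Q n c F) B k hk ?_ ?_ ?_ ?_ η l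
    hF.1 ⟨F, hF⟩ hs a0 ha0 ha0l p0 (hSQ p0 hp0) ?_ ?_
  · rintro n c ⟨G, hG⟩
    refine ⟨hG.2.1, hmax.2 G n c hG, fun p hp => ?_⟩
    have := hG.2.2.1 _ hp
    rw [pairQ_toQ] at this
    exact_mod_cast this
  · intro p hp
    exact (frontier_facet S Q hS h0 p (hBm p hp)).1
  · intro p hp
    obtain ⟨-, n, c, G, hG, e⟩ := frontier_facet S Q hS h0 p (hBm p hp)
    exact ⟨n, c, ⟨G, hG⟩, e⟩
  · intro u hu
    obtain ⟨n, c, G, hG, e, -⟩ := exists_facet S Q hS h0 u hu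
    exact ⟨n, c, ⟨G, hG⟩, e⟩
  · have := hp0m p1 hp1
    rw [hdn] at hp1n
    linarith
  · intro p hp
    exact hbot p (frontier_facet S Q hS h0 p (hBm p hp)).1
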